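/- Let m ∈ M be primitive, P = M/ℤm with projection π, and let g_1,…,g_n be continuous concave functions on polytopes Q_1,…,Q_n ⊆ M_ℝ. Then MI_M(ι_{seg(0,m)}, g_1, …, g_n) = MI_P(π_*g_1, …, π_*g_n), where π_*g denotes the direct image (π_*g)(x) = max_{y ∈ π^{−1}(x) ∩ dom(g)} g(y). -/

import Mathlib

open scoped BigOperators Pointwise
open MeasureTheory

/-- Sup-convolution of a finite family of concave functions with domains. -/
noncomputable def supConv {d : ℕ} {ι : Type*} (S : Finset ι)
    (Q : ι → Set (Fin d → ℝ)) (g : ι → (Fin d → ℝ) → ℝ) (v : Fin d → ℝ) : ℝ :=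
  sSup {t : ℝ | ∃ u : ι → (Fin d → ℝ),
    (∀ i ∈ S, u i ∈ Q i) ∧ (∑ i ∈ S, u i) = v ∧ t = ∑ i ∈ S, g i (u i)}

/-- The mixed integral `MI_μ` of `d+1` concave functions with domains `Q_i`. -/
noncomputable def mixedInt {d : ℕ} (μ : Measure (Fin d → ℝ))
    (Q : Fin (d + 1) → Set (Fin d → ℝ)) (g : Fin (d + 1) → (Fin d → ℝ) → ℝ) : ℝ :=
  ∑ S ∈ Finset.univ.powerset.erase (∅ : Finset (Fin (d + 1))),
    (-1 : ℝ) ^ (d + 1 - S.card) * ∫ x in (∑ i ∈ S, Q i), supConv S Q g x ∂μ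

/-- A point of `ℝ^d` lying in the standard lattice `ℤ^d`. -/
def IsLatticePt {d : ℕ} (x : Fin d → ℝ) : Prop := ∀ i, ∃ z : ℤ, x i = (z : ℝ)

open Set in
lemma int_of_smul_prim {d : ℕ} (m : Fin d → ℤ) (hm : m ≠ 0)
    (hprim : ∀ (k : ℕ) (m' : Fin d → ℤ), 2 ≤ k → m ≠ (k : ℤ) • m')
    (r : ℝ) (z : Fin d → ℤ) (h : ∀ i, r * (m i : ℝ) = z i) : ∃ k : ℤ, r = k := by
  obtain ⟨i0, hi0⟩ : ∃ i, m i ≠ 0 := by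
    by_contra hc
    push Not at hc
    exact hm (funext hc)
  have hi0' : (m i0 : ℝ) ≠ 0 := by exact_mod_cast hi0
  set q : ℚ := (z i0 : ℚ) / (m i0 : ℚ) with hq
  have hrq : r = (q : ℝ) := by
    rw [hq]; push_cast
    rw [eq_div_iff hi0']; exact h i0
  have hmul : ∀ i, q * (m i : ℚ) = z i := by
    intro i
    have := h i
    rw [hrq] at this
    exact_mod_cast this
  have hden : ∀ i, (q.den : ℤ) ∣ m i := by
    intro i
    have h1 : (q.num : ℚ) * m i = z i * q.den := by
      have h2 := hmul i
      have h3 : (q.num : ℚ) = q * q.den := (Rat.mul_den_eq_num q).symm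
      rw [h3, ← h2]; ring
    have h4 : q.num * m i = z i * (q.den : ℤ) := by exact_mod_cast h1
    have hc : IsCoprime (q.den : ℤ) q.num := by
      rw [Int.isCoprime_iff_gcd_eq_one, Int.gcd_comm]
      simpa [Int.gcd] using q.reduced
    exact hc.dvd_of_dvd_mul_left ⟨z i, by rw [h4]; ring⟩
  choose m' hm' using hden
  have hd1 : ¬ 2 ≤ q.den := fun h2 => hprim q.den m' h2 (by funext i; simp [hm' i])
  have hd : q.den = 1 := by have := q.pos; omega
  refine ⟨q.num, ?_⟩
  rw [hrq]
  have : q = q.num := by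
    have := Rat.mul_den_eq_num q
    rw [hd] at this; simpa using this
  exact_mod_cast congrArg (fun x : ℚ => (x : ℝ)) this

lemma exists_section {n : ℕ} (m : Fin (n + 1) → ℤ) (hm : m ≠ 0)
    (hprim : ∀ (k : ℕ) (m' : Fin (n + 1) → ℤ), 2 ≤ k → m ≠ (k : ℤ) • m')
    (π : (Fin (n + 1) → ℝ) →ₗ[ℝ] (Fin n → ℝ))
    (hker : LinearMap.ker π = Submodule.span ℝ {fun i => (m i : ℝ)})
    (hlat : π '' {x | IsLatticePt x} = {y | IsLatticePt y}) :
    ∃ σ : (Fin n → ℝ) →ₗ[ℝ] (Fin (n + 1) → ℝ), (∀ y, π (σ y) = y) ∧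
      MeasurePreserving (fun p : ℝ × (Fin n → ℝ) => p.1 • (fun i => (m i : ℝ)) + σ p.2)
        volume volume := by
  classical
  have hb : ∀ k : Fin n, ∃ b : Fin (n + 1) → ℤ, π (fun i => (b i : ℝ)) = Pi.single k 1 := by
    intro k
    have : (Pi.single k 1 : Fin n → ℝ) ∈ {y | IsLatticePt y} := by
      intro i
      by_cases h : i = k
      · subst h; exact ⟨1, by simp⟩
      · exact ⟨0, by simp [h]⟩
    rw [← hlat] at this
    obtain ⟨x, hx, hx'⟩ := this
    choose z hz using hx
    exact ⟨z, by rw [← hx']; congr 1; funext i; exact (hz i).symm⟩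
  choose b hb using hb
  let σ : (Fin n → ℝ) →ₗ[ℝ] (Fin (n + 1) → ℝ) :=
    Fintype.linearCombination ℝ (fun k => (fun i => (b k i : ℝ)))
  have hσ : ∀ y, σ y = ∑ k, y k • (fun i => (b k i : ℝ)) := fun y => rfl
  have hπσ : ∀ y, π (σ y) = y := by
    intro y
    rw [hσ, map_sum]
    simp only [map_smul, hb]
    funext i
    simp [Finset.sum_apply, Pi.single_apply]
  refine ⟨σ, hπσ, ?_⟩
  let B : Matrix (Fin (n + 1)) (Fin (n + 1)) ℤ :=
    fun i j => (Fin.cons (m i) (fun k => b k i) : Fin (n + 1) → ℤ) j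
  -- inverse
  have hC : ∀ j : Fin (n + 1), ∃ c : Fin (n + 1) → ℤ, B.mulVec c = Pi.single j 1 := by
    intro j
    have hlp : IsLatticePt (π (Pi.single j 1)) := by
      have : π (Pi.single j 1) ∈ {y | IsLatticePt y} := by
        rw [← hlat]
        refine ⟨_, ?_, rfl⟩
        intro i
        by_cases h : i = j
        · subst h; exact ⟨1, by simp⟩
        · exact ⟨0, by simp [h]⟩
      exact this
    choose w hw using hlp
    have hk : (Pi.single j 1 - σ (π (Pi.single j 1)) : Fin (n + 1) → ℝ) ∈ LinearMap.ker π := by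
      simp [hπσ]
    rw [hker, Submodule.mem_span_singleton] at hk
    obtain ⟨r, hr⟩ := hk
    have hr' : ∀ i, r * (m i : ℝ) = (Pi.single j 1 : Fin (n + 1) → ℝ) i - ∑ k, (w k : ℝ) * b k i := by
      intro i
      have := congrFun hr i
      simp only [hσ, Pi.smul_apply, smul_eq_mul, Pi.sub_apply, Finset.sum_apply, hw] at this
      exact this
    have hs : ∀ i, (Pi.single j 1 : Fin (n + 1) → ℝ) i = (((Pi.single j 1 : Fin (n + 1) → ℤ) i : ℤ) : ℝ) := by
      intro i
      by_cases h : i = j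
      · subst h; simp
      · simp [h]
    obtain ⟨k0, hk0⟩ := int_of_smul_prim m hm hprim r
      (fun i => (Pi.single j 1 : Fin (n + 1) → ℤ) i - ∑ k, w k * b k i) (by
        intro i; rw [hr', hs]; push_cast; rfl)
    refine ⟨Fin.cons k0 w, ?_⟩
    funext i
    have := hr' i
    rw [hk0, hs] at this
    have h2 : k0 * m i = (Pi.single j 1 : Fin (n + 1) → ℤ) i - ∑ k, w k * b k i := by
      exact_mod_cast this
    simp only [Matrix.mulVec, dotProduct, Fin.sum_univ_succ, B, Fin.cons_zero, Fin.cons_succ]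
    rw [mul_comm (m i), h2]
    simp [mul_comm]
  choose c hc using hC
  have hBC : B * (Matrix.of fun i j => c j i) = 1 := by
    ext i j
    have := congrFun (hc j) i
    simp only [Matrix.mulVec, dotProduct] at this
    simp only [Matrix.mul_apply, Matrix.of_apply, this, Matrix.one_apply, Pi.single_apply]
  have hdet : IsUnit B.det := by
    have := congrArg Matrix.det hBC
    rw [Matrix.det_mul, Matrix.det_one] at this
    exact IsUnit.of_mul_eq_one _ this
  let BR : Matrix (Fin (n + 1)) (Fin (n + 1)) ℝ := B.map (Int.castRingHom ℝ)
  have hdetR : BR.det = (B.det : ℝ) := by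
    have := (Int.castRingHom ℝ).map_det B
    simpa [BR] using this.symm
  have habs : |BR.det⁻¹| = 1 := by
    rw [hdetR]
    rcases Int.isUnit_iff.mp hdet with h | h <;> simp [h]
  have hne : BR.det ≠ 0 := by
    intro h; rw [h] at habs; simp at habs
  have hmp : MeasurePreserving (Matrix.toLin' BR) volume volume := by
    refine ⟨(LinearMap.continuous_of_finiteDimensional _).measurable, ?_⟩
    rw [Real.map_matrix_volume_pi_eq_smul_volume_pi hne, habs]
    simp
  have h2 := (volume_preserving_piFinSuccAbove (fun _ : Fin (n + 1) => ℝ) 0).symm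
  have h3 := hmp.comp h2
  have h4 : (fun p : ℝ × (Fin n → ℝ) => p.1 • (fun i => (m i : ℝ)) + σ p.2) =
      (Matrix.toLin' BR) ∘ (MeasurableEquiv.piFinSuccAbove (fun _ : Fin (n + 1) => ℝ) 0).symm := by
    funext p
    funext i
    simp [Matrix.mulVec, dotProduct, Fin.sum_univ_succ, BR, B, hσ, MeasurableEquiv.piFinSuccAbove, mul_comm,
      Matrix.map]
  rw [h4]
  exact h3

lemma vol_interval (I : Set ℝ) (hI : IsCompact I) (hc : Convex ℝ I) (hne : I.Nonempty) :
    volume (I + Set.Icc (0 : ℝ) 1) = volume I + 1 := by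
  have h := eq_Icc_of_connected_compact (hc.isConnected hne) hI
  have hle : sInf I ≤ sSup I := by
    rw [h] at hne
    exact Set.nonempty_Icc.mp hne
  rw [h, Set.Icc_add_Icc hle zero_le_one, Real.volume_Icc, Real.volume_Icc, ← ENNReal.ofReal_one,
    ← ENNReal.ofReal_add (by linarith) zero_le_one]
  congr 1; ring

lemma vol_key {n : ℕ} (v : Fin (n + 1) → ℝ) (hv : v ≠ 0)
    (π : (Fin (n + 1) → ℝ) →ₗ[ℝ] (Fin n → ℝ))
    (hker : LinearMap.ker π = Submodule.span ℝ {v})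
    (σ : (Fin n → ℝ) →ₗ[ℝ] (Fin (n + 1) → ℝ)) (hσ : ∀ y, π (σ y) = y)
    (hmp : MeasurePreserving (fun p : ℝ × (Fin n → ℝ) => p.1 • v + σ p.2) volume volume)
    (A : Set (Fin (n + 1) → ℝ)) (hA : IsCompact A) (hAc : Convex ℝ A) :
    volume (A + segment ℝ 0 v) = volume A + volume (π '' A) := by
  have hπc : Continuous π := LinearMap.continuous_of_finiteDimensional _
  have hσc : Continuous σ := LinearMap.continuous_of_finiteDimensional _
  have hseg : segment ℝ 0 v = (fun t : ℝ => t • v) '' Set.Icc 0 1 := by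
    rw [segment_eq_image]; simp
  have hsc : IsCompact (segment ℝ 0 v) := by
    rw [hseg]; exact isCompact_Icc.image (by fun_prop)
  have hπv : π v = 0 := by
    have : v ∈ LinearMap.ker π := by rw [hker]; exact Submodule.mem_span_singleton_self v
    exact this
  have hπA : MeasurableSet (π '' A) := (hA.image hπc).measurableSet
  rw [← hmp.measure_preimage (hA.add hsc).measurableSet.nullMeasurableSet,
    ← hmp.measure_preimage hA.measurableSet.nullMeasurableSet, Measure.volume_eq_prod,
    Measure.prod_apply_symm (hmp.measurable (hA.add hsc).measurableSet),
    Measure.prod_apply_symm (hmp.measurable hA.measurableSet),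
    ← lintegral_indicator_one hπA, ← lintegral_add_right _ (measurable_one.indicator hπA)]
  refine lintegral_congr fun y => ?_
  set I : Set ℝ := (fun r : ℝ => r • v + σ y) ⁻¹' A with hIdef
  have e1 : (fun x : ℝ => (x, y)) ⁻¹' ((fun p : ℝ × (Fin n → ℝ) => p.1 • v + σ p.2) ⁻¹' A) = I := rfl
  have e2 : (fun x : ℝ => (x, y)) ⁻¹' ((fun p : ℝ × (Fin n → ℝ) => p.1 • v + σ p.2) ⁻¹'
      (A + segment ℝ 0 v)) = I + Set.Icc (0 : ℝ) 1 := by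
    ext r
    simp only [Set.mem_preimage, hseg, Set.mem_add, Set.mem_image, hIdef]
    constructor
    · rintro ⟨a, ha, _, ⟨t, ht, rfl⟩, h⟩
      refine ⟨r - t, ?_, t, ht, by ring⟩
      have : (r - t) • v + σ y = a := by
        rw [sub_smul]; rw [← sub_eq_zero] at h ⊢; rw [← neg_eq_zero, ← h]; abel
      rwa [this]
    · rintro ⟨s, hs, t, ht, rfl⟩
      refine ⟨_, hs, _, ⟨t, ht, rfl⟩, ?_⟩
      rw [add_smul]; abel
  rw [e1, e2]
  by_cases hy : y ∈ π '' A
  · rw [Set.indicator_of_mem hy, Pi.one_apply]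
    apply vol_interval
    · have hce : Topology.IsClosedEmbedding (fun r : ℝ => r • v + σ y) := 
        (Homeomorph.addRight (σ y)).isClosedEmbedding.comp (isClosedEmbedding_smul_left hv)
      exact hce.isCompact_preimage hA
    · have := hAc.affine_preimage (AffineMap.lineMap (σ y) (v + σ y) : ℝ →ᵃ[ℝ] _)
      have h5 : I = (AffineMap.lineMap (σ y) (v + σ y) : ℝ →ᵃ[ℝ] _) ⁻¹' A := by
        ext r
        simp [hIdef, AffineMap.lineMap_apply]
      rw [h5]
      exact this
    · obtain ⟨x, hx, hxy⟩ := hy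
      have hk : x - σ y ∈ LinearMap.ker π := by simp [hσ, hxy]
      rw [hker, Submodule.mem_span_singleton] at hk
      obtain ⟨r, hr⟩ := hk
      exact ⟨r, by simp only [hIdef, Set.mem_preimage, hr]; simpa using hx⟩
  · have hI : I = ∅ := by
      rw [Set.eq_empty_iff_forall_notMem]
      intro r hr
      exact hy ⟨_, hr, by simp [hσ, hπv]⟩
    rw [hI, Set.indicator_of_notMem hy]; simp

lemma layer {d : ℕ} (K : Set (Fin d → ℝ)) (hK : IsCompact K) (f : (Fin d → ℝ) → ℝ)
    (hf : ∀ t, IsCompact {x | x ∈ K ∧ t ≤ f x}) (c C : ℝ) (hc : ∀ x ∈ K, c ≤ f x)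
    (hC : ∀ x ∈ K, f x ≤ C) :
    (∫⁻ t in Set.Ioi (0 : ℝ), volume {x | x ∈ K ∧ c + t ≤ f x}) ≠ ⊤ ∧
    ∫ x in K, f x = c * (volume K).toReal +
      (∫⁻ t in Set.Ioi (0 : ℝ), volume {x | x ∈ K ∧ c + t ≤ f x}).toReal := by
  have hKm := hK.measurableSet
  have hKfin : volume K ≠ ⊤ := hK.measure_lt_top.ne
  have hmeas : AEMeasurable f (volume.restrict K) := by
    apply aemeasurable_restrict_of_measurable_subtype hKm
    apply measurable_of_Ici
    intro t
    have : (fun x : K => f x) ⁻¹' Set.Ici t = Subtype.val ⁻¹' {x | x ∈ K ∧ t ≤ f x} := by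
      ext x; simp
    rw [this]
    exact measurable_subtype_coe (hf t).measurableSet
  have hint : IntegrableOn f K := by
    refine Integrable.mono' (g := fun _ => max |c| |C|) ?_ hmeas.aestronglyMeasurable ?_
    · exact integrableOn_const hKfin
    · refine (ae_restrict_iff' hKm).mpr (Filter.Eventually.of_forall fun x hx => ?_)
      rw [Real.norm_eq_abs]
      exact abs_le_max_abs_abs (hc x hx) (hC x hx)
  have hcint : IntegrableOn (fun _ : Fin d → ℝ => c) K := integrableOn_const hKfin
  have hnn : 0 ≤ᵐ[volume.restrict K] fun x => f x - c :=
    (ae_restrict_iff' hKm).mpr (Filter.Eventually.of_forall fun x hx => by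
      simpa using hc x hx)
  have hlc := lintegral_eq_lintegral_meas_le (volume.restrict K) hnn (hmeas.sub_const c)
  have hset : ∀ t : ℝ, (volume.restrict K) {a | t ≤ f a - c} = volume {x | x ∈ K ∧ c + t ≤ f x} := by
    intro t
    rw [Measure.restrict_apply' hKm]
    congr 1
    ext x
    simp only [Set.mem_inter_iff, Set.mem_ofPred_eq]
    constructor
    · rintro ⟨h1, h2⟩; exact ⟨h2, by linarith⟩
    · rintro ⟨h1, h2⟩; exact ⟨by linarith, h1⟩
  simp only [hset] at hlc
  rw [← hlc]
  have hI : Integrable (fun x => f x - c) (volume.restrict K) := hint.sub hcint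
  constructor
  · rw [← ofReal_integral_eq_lintegral_ofReal hI hnn]
    exact ENNReal.ofReal_ne_top
  · rw [← integral_eq_lintegral_of_nonneg_ae hnn hI.aestronglyMeasurable,
      integral_sub hint hcint, setIntegral_const]
    simp [Measure.real, mul_comm]

lemma int_key {n : ℕ} (v : Fin (n + 1) → ℝ) (hv : v ≠ 0)
    (π : (Fin (n + 1) → ℝ) →ₗ[ℝ] (Fin n → ℝ))
    (hker : LinearMap.ker π = Submodule.span ℝ {v})
    (σ : (Fin n → ℝ) →ₗ[ℝ] (Fin (n + 1) → ℝ)) (hσ : ∀ y, π (σ y) = y)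
    (hmp : MeasurePreserving (fun p : ℝ × (Fin n → ℝ) => p.1 • v + σ p.2) volume volume)
    (K : Set (Fin (n + 1) → ℝ)) (hK : IsCompact K) (hKc : Convex ℝ K)
    (f F : (Fin (n + 1) → ℝ) → ℝ) (h : (Fin n → ℝ) → ℝ)
    (hf : ∀ t, IsCompact {x | x ∈ K ∧ t ≤ f x})
    (hfc : ∀ t, Convex ℝ {x | x ∈ K ∧ t ≤ f x})
    (hF : ∀ t, {x | x ∈ K + segment ℝ 0 v ∧ t ≤ F x} = {x | x ∈ K ∧ t ≤ f x} + segment ℝ 0 v)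
    (hh : ∀ t, {x | x ∈ π '' K ∧ t ≤ h x} = π '' {x | x ∈ K ∧ t ≤ f x})
    (c C : ℝ) (hc : ∀ x ∈ K, c ≤ f x) (hC : ∀ x ∈ K, f x < C) :
    ∫ x in K + segment ℝ 0 v, F x = (∫ x in K, f x) + ∫ x in π '' K, h x := by
  have hπc : Continuous π := LinearMap.continuous_of_finiteDimensional _
  have hsc : IsCompact (segment ℝ 0 v) := by
    rw [segment_eq_image]; exact isCompact_Icc.image (by fun_prop)
  have hAc : {x | x ∈ K ∧ c ≤ f x} = K := by
    ext x; exact ⟨fun h => h.1, fun h => ⟨h, hc x h⟩⟩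
  have hAC : {x | x ∈ K ∧ C ≤ f x} = ∅ := by
    rw [Set.eq_empty_iff_forall_notMem]
    rintro x ⟨h1, h2⟩
    exact absurd (hC x h1) (not_lt.mpr h2)
  have vk := vol_key v hv π hker σ hσ hmp
  have hFcpt : ∀ t, IsCompact {x | x ∈ K + segment ℝ 0 v ∧ t ≤ F x} := fun t => by
    rw [hF]; exact (hf t).add hsc
  have hhcpt : ∀ t, IsCompact {x | x ∈ π '' K ∧ t ≤ h x} := fun t => by
    rw [hh]; exact (hf t).image hπc
  have hFc : ∀ x ∈ K + segment ℝ 0 v, c ≤ F x := by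
    intro x hx
    have := hF c
    rw [hAc] at this
    rw [← this] at hx
    exact hx.2
  have hFC : ∀ x ∈ K + segment ℝ 0 v, F x ≤ C := by
    intro x hx
    by_contra hcon
    have h1 : x ∈ {x | x ∈ K + segment ℝ 0 v ∧ C ≤ F x} := ⟨hx, (not_le.mp hcon).le⟩
    rw [hF, hAC, Set.empty_add] at h1
    exact h1
  have hhc : ∀ x ∈ π '' K, c ≤ h x := by
    intro x hx
    have := hh c
    rw [hAc] at this
    rw [← this] at hx
    exact hx.2
  have hhC : ∀ x ∈ π '' K, h x ≤ C := by
    intro x hx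
    by_contra hcon
    have h1 : x ∈ {x | x ∈ π '' K ∧ C ≤ h x} := ⟨hx, (not_le.mp hcon).le⟩
    rw [hh, hAC, Set.image_empty] at h1
    exact h1
  obtain ⟨f1, f2⟩ := layer K hK f hf c C hc (fun x hx => (hC x hx).le)
  obtain ⟨F1, F2⟩ := layer _ (hK.add hsc) F hFcpt c C hFc hFC
  obtain ⟨h1, h2⟩ := layer _ (hK.image hπc) h hhcpt c C hhc hhC
  have hanti : Measurable fun t : ℝ => volume {x | x ∈ K ∧ c + t ≤ f x} := by
    apply Antitone.measurable
    intro s t hst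
    exact measure_mono fun x hx => ⟨hx.1, by linarith [hx.2]⟩
  have hsum : (∫⁻ t in Set.Ioi (0 : ℝ), volume {x | x ∈ K + segment ℝ 0 v ∧ c + t ≤ F x}) =
      (∫⁻ t in Set.Ioi (0 : ℝ), volume {x | x ∈ K ∧ c + t ≤ f x}) +
      ∫⁻ t in Set.Ioi (0 : ℝ), volume {x | x ∈ π '' K ∧ c + t ≤ h x} := by
    rw [← lintegral_add_left hanti]
    refine lintegral_congr fun t => ?_
    rw [hF, hh, vk _ (hf _) (hfc _)]
  rw [F2, f2, h2, hsum, vk K hK hKc, ENNReal.toReal_add f1 h1,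
    ENNReal.toReal_add hK.measure_lt_top.ne (hK.image hπc).measure_lt_top.ne]
  ring

/-- Superlevel description of a direct image along a map, by compactness. -/
lemma le_sSup_image_iff {X Y : Type*} [TopologicalSpace X] [TopologicalSpace Y] [T1Space Y]
    (W : Set X) (hW : IsCompact W) (φ : X → ℝ) (hφ : ContinuousOn φ W) (p : X → Y)
    (hp : Continuous p) (y : Y) (hy : y ∈ p '' W) (t : ℝ) :
    t ≤ sSup (φ '' (W ∩ p ⁻¹' {y})) ↔ ∃ u ∈ W, p u = y ∧ t ≤ φ u := by
  have hc : IsCompact (W ∩ p ⁻¹' {y}) := hW.inter_right (isClosed_singleton.preimage hp)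
  have hne : (W ∩ p ⁻¹' {y}).Nonempty := by
    obtain ⟨u, hu, rfl⟩ := hy
    exact ⟨u, hu, rfl⟩
  have him := hc.image_of_continuousOn (hφ.mono Set.inter_subset_left)
  constructor
  · intro h
    obtain ⟨u, hu, hu'⟩ := him.sSup_mem (hne.image φ)
    exact ⟨u, hu.1, hu.2, by rw [hu']; exact h⟩
  · rintro ⟨u, hu, hu', h⟩
    exact h.trans (le_csSup him.bddAbove ⟨u, ⟨hu, hu'⟩, rfl⟩)

section fam
variable {d : ℕ} {ι : Type*} [Fintype ι]

open Classical in
/-- Normalized product of the domains. -/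
def famW (T : Finset ι) (Q : ι → Set (Fin d → ℝ)) : Set (ι → (Fin d → ℝ)) :=
  Set.univ.pi fun i => if i ∈ T then Q i else {0}

lemma mem_famW {T : Finset ι} {Q : ι → Set (Fin d → ℝ)} {u : ι → (Fin d → ℝ)} :
    u ∈ famW T Q ↔ (∀ i ∈ T, u i ∈ Q i) ∧ ∀ i ∉ T, u i = 0 := by
  simp only [famW, Set.mem_univ_pi]
  constructor
  · intro h
    refine ⟨fun i hi => by simpa [hi] using h i, fun i hi => by simpa [hi] using h i⟩
  · rintro ⟨h1, h2⟩ i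
    by_cases hi : i ∈ T
    · simpa [hi] using h1 i hi
    · simpa [hi] using h2 i hi

lemma famW_compact (T : Finset ι) (Q : ι → Set (Fin d → ℝ)) (hQ : ∀ i, IsCompact (Q i)) :
    IsCompact (famW T Q) := by
  apply isCompact_univ_pi
  intro i
  split_ifs
  · exact hQ i
  · exact isCompact_singleton

lemma famW_convex (T : Finset ι) (Q : ι → Set (Fin d → ℝ)) (hQ : ∀ i, Convex ℝ (Q i)) :
    Convex ℝ (famW T Q) := by
  apply convex_pi
  intro i _
  split_ifs
  · exact hQ i
  · exact convex_singleton 0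

lemma fam_cont (T : Finset ι) (Q : ι → Set (Fin d → ℝ)) (g : ι → (Fin d → ℝ) → ℝ)
    (hg : ∀ i, ContinuousOn (g i) (Q i)) :
    ContinuousOn (fun u : ι → (Fin d → ℝ) => ∑ i ∈ T, g i (u i)) (famW T Q) := by
  apply continuousOn_finsetSum
  intro i hi
  exact (hg i).comp (continuous_apply i).continuousOn fun u hu => (mem_famW.mp hu).1 i hi

lemma fam_conc (T : Finset ι) (Q : ι → Set (Fin d → ℝ)) (g : ι → (Fin d → ℝ) → ℝ)
    (hg : ∀ i, ConcaveOn ℝ (Q i) (g i)) :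
    ConcaveOn ℝ (famW T Q) (fun u : ι → (Fin d → ℝ) => ∑ i ∈ T, g i (u i)) := by
  refine ⟨famW_convex T Q fun i => (hg i).1, ?_⟩
  intro x hx y hy a b ha hb hab
  simp only [smul_eq_mul, Finset.mul_sum, ← Finset.sum_add_distrib]
  refine Finset.sum_le_sum fun i hi => ?_
  exact (hg i).2 ((mem_famW.mp hx).1 i hi) ((mem_famW.mp hy).1 i hi) ha hb hab

open Classical in
lemma famW_trunc {T : Finset ι} {Q : ι → Set (Fin d → ℝ)} {u : ι → (Fin d → ℝ)}
    (h : ∀ i ∈ T, u i ∈ Q i) : ∃ u' ∈ famW T Q, ∀ i ∈ T, u' i = u i := by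
  refine ⟨fun i => if i ∈ T then u i else 0, mem_famW.mpr ⟨fun i hi => by simpa [hi] using h i hi,
    fun i hi => by simp [hi]⟩, fun i hi => by simp [hi]⟩

lemma famW_image (T : Finset ι) (Q : ι → Set (Fin d → ℝ)) :
    (fun u : ι → (Fin d → ℝ) => ∑ i ∈ T, u i) '' famW T Q = ∑ i ∈ T, Q i := by
  ext x
  rw [Set.mem_finsetSum]
  constructor
  · rintro ⟨u, hu, rfl⟩
    exact ⟨u, fun {i} hi => (mem_famW.mp hu).1 i hi, rfl⟩
  · rintro ⟨u, hu, rfl⟩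
    obtain ⟨u', h1, h2⟩ := famW_trunc (fun i hi => hu hi)
    exact ⟨u', h1, Finset.sum_congr rfl h2⟩

lemma supConv_eq (T : Finset ι) (Q : ι → Set (Fin d → ℝ)) (g : ι → (Fin d → ℝ) → ℝ)
    (x : Fin d → ℝ) :
    supConv T Q g x = sSup ((fun u : ι → (Fin d → ℝ) => ∑ i ∈ T, g i (u i)) ''
      (famW T Q ∩ (fun u : ι → (Fin d → ℝ) => ∑ i ∈ T, u i) ⁻¹' {x})) := by
  unfold supConv
  congr 1
  ext t
  constructor
  · rintro ⟨u, hu, rfl, rfl⟩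
    obtain ⟨u', h1, h2⟩ := famW_trunc hu
    exact ⟨u', ⟨h1, Finset.sum_congr rfl h2⟩, Finset.sum_congr rfl fun i hi => by rw [h2 i hi]⟩
  · rintro ⟨u, ⟨hu, hx⟩, rfl⟩
    exact ⟨u, (mem_famW.mp hu).1, hx, rfl⟩

lemma le_supConv_iff (T : Finset ι) (Q : ι → Set (Fin d → ℝ)) (hQ : ∀ i, IsCompact (Q i))
    (g : ι → (Fin d → ℝ) → ℝ) (hg : ∀ i, ContinuousOn (g i) (Q i)) (t : ℝ) :
    {x | x ∈ ∑ i ∈ T, Q i ∧ t ≤ supConv T Q g x} =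
      {x | ∃ u : ι → (Fin d → ℝ), (∀ i ∈ T, u i ∈ Q i) ∧ ∑ i ∈ T, u i = x ∧
        t ≤ ∑ i ∈ T, g i (u i)} := by
  ext x
  rw [← famW_image]
  constructor
  · rintro ⟨hx, h⟩
    rw [supConv_eq, le_sSup_image_iff _ (famW_compact T Q hQ) _ (fam_cont T Q g hg) _ (by fun_prop) x hx]
      at h
    obtain ⟨u, hu, h1, h2⟩ := h
    exact ⟨u, (mem_famW.mp hu).1, h1, h2⟩
  · rintro ⟨u, hu, rfl, ht⟩
    obtain ⟨u', h1, h2⟩ := famW_trunc hu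
    have e : ∑ i ∈ T, u' i = ∑ i ∈ T, u i := Finset.sum_congr rfl h2
    have hx : ∑ i ∈ T, u i ∈ (fun u : ι → (Fin d → ℝ) => ∑ i ∈ T, u i) '' famW T Q := ⟨u', h1, e⟩
    refine ⟨hx, ?_⟩
    rw [supConv_eq, le_sSup_image_iff _ (famW_compact T Q hQ) _ (fam_cont T Q g hg) _ (by fun_prop) _ hx]
    exact ⟨u', h1, e, by rw [Finset.sum_congr rfl fun i hi => by rw [h2 i hi]]; exact ht⟩

lemma superlevel_image (T : Finset ι) (Q : ι → Set (Fin d → ℝ)) (g : ι → (Fin d → ℝ) → ℝ) (t : ℝ) :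
      {x | ∃ u : ι → (Fin d → ℝ), (∀ i ∈ T, u i ∈ Q i) ∧ ∑ i ∈ T, u i = x ∧
        t ≤ ∑ i ∈ T, g i (u i)} = (∑ i ∈ T, LinearMap.proj i : (ι → (Fin d → ℝ)) →ₗ[ℝ] (Fin d → ℝ)) ''
          {u | u ∈ famW T Q ∧ t ≤ ∑ i ∈ T, g i (u i)} := by
  ext x
  constructor
  · rintro ⟨u, hu, rfl, ht⟩
    obtain ⟨u', h1, h2⟩ := famW_trunc hu
    refine ⟨u', ⟨h1, ?_⟩, ?_⟩
    · rw [Finset.sum_congr rfl fun i hi => by rw [h2 i hi]]; exact ht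
    · simpa using Finset.sum_congr rfl h2
  · rintro ⟨u, ⟨hu, ht⟩, rfl⟩
    exact ⟨u, (mem_famW.mp hu).1, by simp, ht⟩

lemma superlevel_compact (T : Finset ι) (Q : ι → Set (Fin d → ℝ)) (hQ : ∀ i, IsCompact (Q i))
    (g : ι → (Fin d → ℝ) → ℝ) (hg : ∀ i, ContinuousOn (g i) (Q i)) (t : ℝ) :
    IsCompact {x | x ∈ ∑ i ∈ T, Q i ∧ t ≤ supConv T Q g x} := by
  rw [le_supConv_iff T Q hQ g hg, superlevel_image]
  refine IsCompact.image ?_ (LinearMap.continuous_of_finiteDimensional _)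
  have := (fam_cont T Q g hg).preimage_isClosed_of_isClosed (famW_compact T Q hQ).isClosed
    (isClosed_Ici (a := t))
  exact (famW_compact T Q hQ).of_isClosed_subset this fun u hu => hu.1

lemma superlevel_convex (T : Finset ι) (Q : ι → Set (Fin d → ℝ)) (hQ : ∀ i, IsCompact (Q i))
    (g : ι → (Fin d → ℝ) → ℝ) (hg : ∀ i, ContinuousOn (g i) (Q i))
    (hg' : ∀ i, ConcaveOn ℝ (Q i) (g i)) (t : ℝ) :
    Convex ℝ {x | x ∈ ∑ i ∈ T, Q i ∧ t ≤ supConv T Q g x} := by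
  rw [le_supConv_iff T Q hQ g hg, superlevel_image]
  exact ((fam_conc T Q g hg').convex_ge t).linear_image _

lemma supConv_bounds (T : Finset ι) (Q : ι → Set (Fin d → ℝ)) (hQ : ∀ i, IsCompact (Q i))
    (g : ι → (Fin d → ℝ) → ℝ) (hg : ∀ i, ContinuousOn (g i) (Q i)) :
    ∃ c C : ℝ, (∀ x ∈ ∑ i ∈ T, Q i, c ≤ supConv T Q g x) ∧
      ∀ x ∈ ∑ i ∈ T, Q i, supConv T Q g x < C := by
  have him := (famW_compact T Q hQ).image_of_continuousOn (fam_cont T Q g hg)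
  obtain ⟨c, hc⟩ := him.bddBelow
  obtain ⟨C, hC⟩ := him.bddAbove
  refine ⟨c, C + 1, ?_, ?_⟩
  · intro x hx
    have : x ∈ {x | x ∈ ∑ i ∈ T, Q i ∧ c ≤ supConv T Q g x} := by
      rw [le_supConv_iff T Q hQ g hg, superlevel_image]
      rw [← famW_image] at hx
      obtain ⟨u, hu, rfl⟩ := hx
      exact ⟨u, ⟨hu, hc ⟨u, hu, rfl⟩⟩, by simp⟩
    exact this.2
  · intro x hx
    by_contra hcon
    have : x ∈ {x | x ∈ ∑ i ∈ T, Q i ∧ C + 1 ≤ supConv T Q g x} := ⟨hx, not_lt.mp hcon⟩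
    rw [le_supConv_iff T Q hQ g hg, superlevel_image] at this
    obtain ⟨u, ⟨hu, h2⟩, -⟩ := this
    have : ∑ i ∈ T, g i (u i) ≤ C := hC ⟨u, hu, rfl⟩
    linarith

lemma le_supConv_push {e : ℕ} (π : (Fin d → ℝ) →ₗ[ℝ] (Fin e → ℝ))
    (T : Finset ι) (Q : ι → Set (Fin d → ℝ)) (hQ : ∀ i, IsCompact (Q i))
    (g : ι → (Fin d → ℝ) → ℝ) (hg : ∀ i, ContinuousOn (g i) (Q i)) (t : ℝ) :
    {x | x ∈ π '' (∑ i ∈ T, Q i) ∧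
      t ≤ supConv T (fun i => π '' Q i) (fun i x => sSup (g i '' (Q i ∩ π ⁻¹' {x}))) x} =
      π '' {x | x ∈ ∑ i ∈ T, Q i ∧ t ≤ supConv T Q g x} := by
  classical
  have hπc : Continuous π := LinearMap.continuous_of_finiteDimensional _
  rw [le_supConv_iff T Q hQ g hg]
  have key : ∀ i, ∀ w ∈ π '' Q i, IsGreatest (g i '' (Q i ∩ π ⁻¹' {w}))
      (sSup (g i '' (Q i ∩ π ⁻¹' {w}))) := by
    intro i w hw
    have hc : IsCompact (Q i ∩ π ⁻¹' {w}) := (hQ i).inter_right (isClosed_singleton.preimage hπc)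
    have hne : (Q i ∩ π ⁻¹' {w}).Nonempty := by
      obtain ⟨u, hu, rfl⟩ := hw
      exact ⟨u, hu, rfl⟩
    exact (hc.image_of_continuousOn ((hg i).mono Set.inter_subset_left)).isGreatest_sSup
      (hne.image _)
  -- lifting
  have lift : ∀ w : ι → (Fin e → ℝ), (∀ i ∈ T, w i ∈ π '' Q i) → ∃ u ∈ famW T Q,
      ∀ i ∈ T, π (u i) = w i ∧ g i (u i) = sSup (g i '' (Q i ∩ π ⁻¹' {w i})) := by
    intro w hw
    have : ∀ i, ∃ v : Fin d → ℝ, i ∈ T → v ∈ Q i ∧ π v = w i ∧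
        g i v = sSup (g i '' (Q i ∩ π ⁻¹' {w i})) := by
      intro i
      by_cases hi : i ∈ T
      · obtain ⟨v, hv, hv'⟩ := (key i (w i) (hw i hi)).1
        exact ⟨v, fun _ => ⟨hv.1, hv.2, hv'⟩⟩
      · exact ⟨0, fun h => absurd h hi⟩
    choose v hv using this
    obtain ⟨u, hu, hu'⟩ := famW_trunc (T := T) (Q := Q) (u := v) fun i hi => (hv i hi).1
    exact ⟨u, hu, fun i hi => by rw [hu' i hi]; exact (hv i hi).2⟩
  let p : (ι → (Fin d → ℝ)) → (Fin e → ℝ) := fun u => π (∑ i ∈ T, u i)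
  have hp : Continuous p := hπc.comp (by fun_prop)
  have main : ∀ x ∈ p '' famW T Q,
      supConv T (fun i => π '' Q i) (fun i x => sSup (g i '' (Q i ∩ π ⁻¹' {x}))) x =
      sSup ((fun u : ι → (Fin d → ℝ) => ∑ i ∈ T, g i (u i)) '' (famW T Q ∩ p ⁻¹' {x})) := by
    intro x hx
    have hc : IsCompact (famW T Q ∩ p ⁻¹' {x}) :=
      (famW_compact T Q hQ).inter_right (isClosed_singleton.preimage hp)
    have hne : (famW T Q ∩ p ⁻¹' {x}).Nonempty := by
      obtain ⟨u, hu, rfl⟩ := hx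
      exact ⟨u, hu, rfl⟩
    have hgr := (hc.image_of_continuousOn
      ((fam_cont T Q g hg).mono Set.inter_subset_left)).isGreatest_sSup (hne.image _)
    set s := sSup ((fun u : ι → (Fin d → ℝ) => ∑ i ∈ T, g i (u i)) '' (famW T Q ∩ p ⁻¹' {x}))
    have hub : ∀ t' ∈ {t : ℝ | ∃ w : ι → (Fin e → ℝ),
        (∀ i ∈ T, w i ∈ π '' Q i) ∧ (∑ i ∈ T, w i) = x ∧
          t = ∑ i ∈ T, sSup (g i '' (Q i ∩ π ⁻¹' {w i}))}, t' ≤ s := by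
      rintro t' ⟨w, hw, hwx, rfl⟩
      obtain ⟨u, hu, hu'⟩ := lift w hw
      refine hgr.2 ⟨u, ⟨hu, ?_⟩, Finset.sum_congr rfl fun i hi => (hu' i hi).2⟩
      change π (∑ i ∈ T, u i) = x
      rw [map_sum, ← hwx]
      exact Finset.sum_congr rfl fun i hi => (hu' i hi).1
    obtain ⟨u, ⟨hu, hux⟩, hus⟩ := hgr.1
    have hmem : (∑ i ∈ T, sSup (g i '' (Q i ∩ π ⁻¹' {π (u i)}))) ∈ {t : ℝ | ∃ w : ι → (Fin e → ℝ),
        (∀ i ∈ T, w i ∈ π '' Q i) ∧ (∑ i ∈ T, w i) = x ∧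
          t = ∑ i ∈ T, sSup (g i '' (Q i ∩ π ⁻¹' {w i}))} := by
      refine ⟨fun i => π (u i), fun i hi => ⟨u i, (mem_famW.mp hu).1 i hi, rfl⟩, ?_, rfl⟩
      rw [← map_sum]; exact hux
    apply le_antisymm
    · exact csSup_le ⟨_, hmem⟩ hub
    · refine le_trans ?_ (le_csSup ⟨s, hub⟩ hmem)
      rw [← hus]
      refine Finset.sum_le_sum fun i hi => ?_
      have hQi := (mem_famW.mp hu).1 i hi
      exact (key i _ ⟨_, hQi, rfl⟩).2 ⟨u i, ⟨hQi, rfl⟩, rfl⟩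
  have hdom : π '' (∑ i ∈ T, Q i) = p '' famW T Q := by
    rw [← famW_image, Set.image_image]
  ext x
  rw [hdom]
  constructor
  · rintro ⟨hx, h⟩
    rw [main x hx, le_sSup_image_iff _ (famW_compact T Q hQ) _ (fam_cont T Q g hg) p hp x hx] at h
    obtain ⟨u, hu, h1, h2⟩ := h
    exact ⟨_, ⟨u, (mem_famW.mp hu).1, rfl, h2⟩, h1⟩
  · rintro ⟨_, ⟨u, hu, rfl, ht⟩, rfl⟩
    obtain ⟨u', h1, h2⟩ := famW_trunc hu
    have e : p u' = π (∑ i ∈ T, u i) := congrArg π (Finset.sum_congr rfl h2)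
    have hx : π (∑ i ∈ T, u i) ∈ p '' famW T Q := ⟨u', h1, e⟩
    refine ⟨hx, ?_⟩
    rw [main _ hx, le_sSup_image_iff _ (famW_compact T Q hQ) _ (fam_cont T Q g hg) p hp _ hx]
    exact ⟨u', h1, e, by rw [Finset.sum_congr rfl fun i hi => by rw [h2 i hi]]; exact ht⟩

end fam

lemma mixedInt_eq {d : ℕ} (μ : Measure (Fin d → ℝ))
    (Q : Fin (d + 1) → Set (Fin d → ℝ)) (g : Fin (d + 1) → (Fin d → ℝ) → ℝ) :
    mixedInt μ Q g = ∑ S ∈ (Finset.univ : Finset (Fin (d + 1))).powerset,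
      (-1 : ℝ) ^ (d + 1 - S.card) * ∫ x in (∑ i ∈ S, Q i), supConv S Q g x ∂μ := by
  unfold mixedInt
  apply Finset.sum_erase
  have : ∀ x, supConv (∅ : Finset (Fin (d + 1))) Q g x = 0 := by
    intro x
    unfold supConv
    by_cases hx : x = 0
    · simp [hx]
    · simp [Ne.symm hx]
  simp [this]

lemma supConv_succ {d k : ℕ} (T : Finset (Fin k)) (q : Set (Fin d → ℝ)) (f : (Fin d → ℝ) → ℝ)
    (Q : Fin k → Set (Fin d → ℝ)) (g : Fin k → (Fin d → ℝ) → ℝ) (x : Fin d → ℝ) :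
    supConv (T.map (Fin.succEmb k)) (Fin.cons q Q) (Fin.cons f g) x = supConv T Q g x := by
  unfold supConv
  congr 1
  ext t
  constructor
  · rintro ⟨u, hu, hx, ht⟩
    refine ⟨fun i => u i.succ, fun i hi => ?_, ?_, ?_⟩
    · simpa using hu i.succ (by simpa using hi)
    · simpa using hx
    · simpa using ht
  · rintro ⟨u, hu, hx, ht⟩
    refine ⟨Fin.cons 0 u, ?_, ?_, ?_⟩
    · intro i hi
      obtain ⟨j, hj, rfl⟩ := Finset.mem_map.mp hi
      simpa using hu j hj
    · simpa using hx
    · simpa using ht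

lemma sum_split {k : ℕ} (h : Finset (Fin (k + 1)) → ℝ) :
    ∑ S ∈ (Finset.univ : Finset (Fin (k + 1))).powerset, h S =
      ∑ T ∈ (Finset.univ : Finset (Fin k)).powerset,
        (h (T.map (Fin.succEmb k)) + h (insert 0 (T.map (Fin.succEmb k)))) := by
  classical
  have e : (Finset.univ : Finset (Fin (k + 1))) =
      insert 0 ((Finset.univ : Finset (Fin k)).image Fin.succ) := by
    ext i
    simp only [Finset.mem_univ, Finset.mem_insert, Finset.mem_image, true_and, true_iff]
    rcases Fin.eq_zero_or_eq_succ i with h | ⟨j, h⟩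
    · exact Or.inl h
    · exact Or.inr ⟨j, h.symm⟩
  have hm : ∀ T : Finset (Fin k), T.image Fin.succ = T.map (Fin.succEmb k) := by
    intro T; ext i; simp
  rw [e, Finset.sum_powerset_insert (by simp), Finset.powerset_image, Finset.sum_image,
    Finset.sum_image, ← Finset.sum_add_distrib]
  · simp only [hm]
  all_goals
    intro a _ b _ hab
    exact Finset.image_injective (Fin.succ_injective k) hab

/-- Let `m` be a primitive vector of the rank-`(n+1)` lattice `M = ℤ^{n+1}` and let
`π : M_ℝ → P_ℝ` realize the quotient lattice `P = M/ℤm` (kernel `ℝm`, mapping `ℤ^{n+1}`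
onto `ℤ^n`).  For continuous concave functions `g_1,…,g_{n+1}` on (nonempty) polytopes
`Q_1,…,Q_{n+1} ⊆ M_ℝ`:
`MI_M(ι_{seg(0,m)}, g_1, …, g_{n+1}) = MI_P(π_*g_1, …, π_*g_{n+1})`,
where the direct image `π_*g` has domain `π(dom g)` and `(π_*g)(x) = max_{y ∈ π^{-1}(x) ∩ dom g} g(y)`,
and the indicator function `ι_{seg(0,m)}` is the zero function with domain the segment. -/
theorem stmt7 {n : ℕ} (m : Fin (n + 1) → ℤ) (hm : m ≠ 0)
    (hprim : ∀ (k : ℕ) (m' : Fin (n + 1) → ℤ), 2 ≤ k → m ≠ (k : ℤ) • m')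
    (π : (Fin (n + 1) → ℝ) →ₗ[ℝ] (Fin n → ℝ))
    (hker : LinearMap.ker π = Submodule.span ℝ {fun i => (m i : ℝ)})
    (hlat : π '' {x | IsLatticePt x} = {y | IsLatticePt y})
    (Q : Fin (n + 1) → Set (Fin (n + 1) → ℝ))
    (hQ : ∀ i, ∃ s : Finset (Fin (n + 1) → ℝ), Q i = convexHull ℝ ↑s)
    (hQne : ∀ i, (Q i).Nonempty)
    (g : Fin (n + 1) → (Fin (n + 1) → ℝ) → ℝ)
    (hconc : ∀ i, ConcaveOn ℝ (Q i) (g i)) (hcont : ∀ i, ContinuousOn (g i) (Q i)) :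
    mixedInt volume (Fin.cons (segment ℝ 0 (fun i => (m i : ℝ))) Q)
        (Fin.cons (fun _ => (0 : ℝ)) g)
      = mixedInt volume (fun i => π '' Q i)
          (fun i x => sSup (g i '' (Q i ∩ π ⁻¹' {x}))) := by
  set v : Fin (n + 1) → ℝ := fun i => (m i : ℝ) with hvdef
  have hv : v ≠ 0 := by
    intro h
    apply hm
    funext i
    have := congrFun h i
    simpa [hvdef] using this
  obtain ⟨σ, hσ, hmp⟩ := exists_section m hm hprim π hker hlat
  have hQc : ∀ i, IsCompact (Q i) := by
    intro i
    obtain ⟨s, hs⟩ := hQ i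
    rw [hs]
    exact s.finite_toSet.isCompact_convexHull ℝ
  have hsc : IsCompact (segment ℝ 0 v) := by
    rw [segment_eq_image]; exact isCompact_Icc.image (by fun_prop)
  rw [mixedInt_eq, mixedInt_eq, sum_split]
  refine Finset.sum_congr rfl fun T _ => ?_
  have hcard : T.card ≤ n + 1 := by simpa using Finset.card_le_univ T
  have h0 : (0 : Fin (n + 1 + 1)) ∉ T.map (Fin.succEmb (n + 1)) := by simp
  let Q' : Fin (n + 1 + 1) → Set (Fin (n + 1) → ℝ) := Fin.cons (segment ℝ 0 v) Q
  let g' : Fin (n + 1 + 1) → (Fin (n + 1) → ℝ) → ℝ := Fin.cons (fun _ => (0 : ℝ)) g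
  have hQ'c : ∀ i, IsCompact (Q' i) := by
    intro i
    refine Fin.cases ?_ (fun j => ?_) i
    · exact hsc
    · exact hQc j
  have hg'c : ∀ i, ContinuousOn (g' i) (Q' i) := by
    intro i
    refine Fin.cases ?_ (fun j => ?_) i
    · exact continuousOn_const
    · exact hcont j
  have d1 : ∑ i ∈ T.map (Fin.succEmb (n + 1)), Q' i = ∑ i ∈ T, Q i := by
    rw [Finset.sum_map]; rfl
  have d2 : ∑ i ∈ insert 0 (T.map (Fin.succEmb (n + 1))), Q' i =
      (∑ i ∈ T, Q i) + segment ℝ 0 v := by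
    rw [Finset.sum_insert h0, d1, add_comm (Q' 0)]; rfl
  have d3 : ∑ i ∈ T, π '' Q i = π '' (∑ i ∈ T, Q i) := (Set.image_finsetSum π T Q).symm
  obtain ⟨c, C, hc, hC⟩ := supConv_bounds T Q hQc g hcont
  have hK : {x | x ∈ ∑ i ∈ T, Q i ∧ c ≤ supConv T Q g x} = ∑ i ∈ T, Q i := by
    ext x; exact ⟨fun h => h.1, fun h => ⟨h, hc x h⟩⟩
  have hKcpt : IsCompact (∑ i ∈ T, Q i) := hK ▸ superlevel_compact T Q hQc g hcont c
  have hKconv : Convex ℝ (∑ i ∈ T, Q i) := hK ▸ superlevel_convex T Q hQc g hcont hconc c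
  have main := int_key v hv π hker σ hσ hmp (∑ i ∈ T, Q i) hKcpt hKconv (supConv T Q g)
    (supConv (insert 0 (T.map (Fin.succEmb (n + 1)))) Q' g')
    (supConv T (fun i => π '' Q i) (fun i x => sSup (g i '' (Q i ∩ π ⁻¹' {x}))))
    (superlevel_compact T Q hQc g hcont) (superlevel_convex T Q hQc g hcont hconc)
    (by
      intro t
      rw [← d2, le_supConv_iff _ Q' hQ'c g' hg'c, le_supConv_iff T Q hQc g hcont]
      ext x
      constructor
      · rintro ⟨u, hu, rfl, ht⟩
        rw [Finset.sum_insert h0, Finset.sum_map] at ht ⊢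
        rw [add_comm (u 0)]
        refine Set.add_mem_add ⟨fun i => u i.succ, fun i hi => ?_, rfl, ?_⟩ (hu 0 (by simp))
        · exact hu i.succ (Finset.mem_insert_of_mem (Finset.mem_map_of_mem _ hi))
        · simpa [g'] using ht
      · rintro ⟨_, ⟨u, hu, rfl, ht⟩, s, hs, rfl⟩
        refine ⟨Fin.cons s u, ?_, ?_, ?_⟩
        · intro i hi
          rcases Finset.mem_insert.mp hi with rfl | hi
          · exact hs
          · obtain ⟨j, hj, rfl⟩ := Finset.mem_map.mp hi
            exact hu j hj
        · rw [Finset.sum_insert h0, Finset.sum_map]; exact add_comm s _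
        · rw [Finset.sum_insert h0, Finset.sum_map]
          simpa [g'] using ht)
    (le_supConv_push π T Q hQc g hcont) c C hc hC
  rw [d3, Finset.card_insert_of_notMem h0, Finset.card_map]
  change _ * (∫ x in ∑ i ∈ T.map (Fin.succEmb (n + 1)), Q' i,
      supConv (T.map (Fin.succEmb (n + 1))) Q' g' x) +
    _ * (∫ x in ∑ i ∈ insert 0 (T.map (Fin.succEmb (n + 1))), Q' i,
      supConv (insert 0 (T.map (Fin.succEmb (n + 1)))) Q' g' x) = _
  rw [d1, d2, main]
  simp only [Q', g', supConv_succ]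
  have e1 : n + 1 + 1 - T.card = (n + 1 - T.card) + 1 := by omega
  have e2 : n + 1 + 1 - (T.card + 1) = n + 1 - T.card := by omega
  rw [e1, e2, pow_succ]
  ring
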